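/- Let Ω = {x ∈ ℝ³ : x₃ ≥ 0}, L₁ = ∂Ω, and let π : ℝ³ → ℝ be π(x₁,x₂,x₃) = x₃. Let Z = Z' ∪ L₁ where Z' is a cone of type ℙ₊ or 𝕐₊, and let E ⊂ Ω be closed with E ⊃ L₁, coinciding with Z outside B(0, r/2), such that for a.e. y ∈ (0,r) the slice E ∩ π⁻¹(y) is a connected closed set coinciding with the line (resp. the Y-net) Z ∩ π⁻¹(y) outside B(0,1). Then H²(E ∩ B(0,r) \ L₁) ≥ H²(Z ∩ B(0,r) \ L₁). The proof uses the coarea inequality H²(E ∩ B(0,r) \ L₁) ≥ ∫₀^r H¹(E ∩ B(0,r) ∩ π⁻¹(y)) dy together with the minimality of a line (resp. Y-net) among connected sets with the same behavior at infinity in each horizontal plane. -/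

import Mathlib

open MeasureTheory Metric Set Filter
open scoped ENNReal NNReal Topology

noncomputable section

abbrev E3 := EuclideanSpace ℝ (Fin 3)

/-- The closed upper half space Ω = {x ∈ ℝ³ : x₃ ≥ 0}. -/
def Omega3 : Set E3 := {p | 0 ≤ p 2}

/-- The boundary plane L₁ = {x ∈ ℝ³ : x₃ = 0}. -/
def Plane3 : Set E3 := {p | p 2 = 0}

/-- The set Ŵ = ⋃_{t∈[0,1]} (W_t ∪ φ_t(W_t)), with W_t = {x : φ_t(x) ≠ x}. -/
def HatW3 (φ : ℝ → E3 → E3) : Set E3 :=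
  ⋃ t ∈ Set.Icc (0:ℝ) 1, ({x | φ t x ≠ x} ∪ φ t '' {x | φ t x ≠ x})

/-- A deformation in ℝ³: φ₀ = id, φ₁ Lipschitz, (t,x) ↦ φ_t(x) continuous on [0,1]×ℝ³,
and Ŵ relatively compact. -/
def IsDeformation3 (φ : ℝ → E3 → E3) : Prop :=
  (∀ x, φ 0 x = x) ∧
  (∃ K : ℝ≥0, LipschitzWith K (φ 1)) ∧
  ContinuousOn (fun p : ℝ × E3 => φ p.1 p.2) (Set.Icc (0:ℝ) 1 ×ˢ Set.univ) ∧
  IsCompact (closure (HatW3 φ))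

/-- A sliding deformation in Ω with sliding boundary L: additionally each φ_t maps Ω into Ω
and L into L. -/
def IsSlidingDeformation3 (Ω L : Set E3) (φ : ℝ → E3 → E3) : Prop :=
  IsDeformation3 φ ∧
  (∀ t ∈ Set.Icc (0:ℝ) 1, Set.MapsTo (φ t) Ω Ω) ∧
  (∀ t ∈ Set.Icc (0:ℝ) 1, Set.MapsTo (φ t) L L)

/-- E is minimal in ℝ³: H²(E ∩ W₁) ≤ H²(φ₁(E ∩ W₁)) for every deformation in ℝ³. -/
def Minimal3 (E : Set E3) : Prop :=
  IsClosed E ∧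
  ∀ φ : ℝ → E3 → E3, IsDeformation3 φ →
    μH[2] (E ∩ {x | φ 1 x ≠ x}) ≤ μH[2] (φ 1 '' (E ∩ {x | φ 1 x ≠ x}))

/-- E is sliding minimal in Ω with sliding boundary L:
H²(E ∩ W₁) ≤ H²(φ₁(E ∩ W₁)) for every sliding deformation. -/
def SlidingMinimal3 (Ω L E : Set E3) : Prop :=
  IsClosed E ∧ E ⊆ Ω ∧
  ∀ φ : ℝ → E3 → E3, IsSlidingDeformation3 Ω L φ →
    μH[2] (E ∩ {x | φ 1 x ≠ x}) ≤ μH[2] (φ 1 '' (E ∩ {x | φ 1 x ≠ x}))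

open scoped RealInnerProductSpace

/-- A cone of type ℙ₊: the intersection of Ω with a plane through 0 perpendicular to L₁,
i.e. a closed half plane {p ∈ Ω : ⟪v,p⟫ = 0} for a unit vector v ∈ L₁. -/
def ConeTypeP (Z : Set E3) : Prop :=
  ∃ v : E3, ‖v‖ = 1 ∧ v 2 = 0 ∧ Z = {p : E3 | 0 ≤ p 2 ∧ ⟪v, p⟫ = 0}

/-- A cone of type 𝕐₊: the intersection of Ω with a cone of type 𝕐 (three half planes meeting
at 120° along a common spine) whose spine is perpendicular to L₁: the union of three quarter
planes spanned by the vertical direction and three horizontal unit vectors at mutual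
angles 2π/3. -/
def ConeTypeY (Z : Set E3) : Prop :=
  ∃ w : Fin 3 → E3, (∀ j, ‖w j‖ = 1 ∧ (w j) 2 = 0) ∧
    (∀ j k, j ≠ k → ⟪w j, w k⟫ = -(1/2)) ∧
    Z = ⋃ j, {p : E3 | ∃ a c : ℝ, 0 ≤ a ∧ 0 ≤ c ∧
      p = a • w j + c • EuclideanSpace.single (2 : Fin 3) (1:ℝ)}

theorem aux_chain {X : Type*} [MetricSpace X] (c : Set (Set X)) (hne : c.Nonempty)
    (hc : IsChain (· ⊆ ·) c) (hcomp : ∀ s ∈ c, IsCompact s) (hconn : ∀ s ∈ c, IsPreconnected s) :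
    IsPreconnected (⋂₀ c) := by
  have hcl : IsClosed (⋂₀ c) := isClosed_sInter fun s hs => (hcomp s hs).isClosed
  rw [isPreconnected_iff_subset_of_fully_disjoint_closed hcl]
  intro u v hu hv huv hd
  obtain ⟨U, V, hU, hV, huU, hvV, hUV⟩ := normal_separation hu hv hd
  have : Nonempty c := hne.to_subtype
  have key : ∃ s : c, (s : Set X) ⊆ U ∪ V := by
    refine exists_subset_nhds_of_isCompact' (V := fun s : c => (s : Set X)) ?_
      (fun s => hcomp s s.2) (fun s => (hcomp s s.2).isClosed) ?_
    · intro a b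
      rcases hc.total a.2 b.2 with h | h
      · exact ⟨a, subset_rfl, h⟩
      · exact ⟨b, h, subset_rfl⟩
    · intro x hx
      rw [← sInter_eq_iInter] at hx
      exact (hU.union hV).mem_nhds ((huv hx).imp (fun h => huU h) (fun h => hvV h))
  obtain ⟨s, hs⟩ := key
  have hsub : ⋂₀ c ⊆ (s : Set X) := sInter_subset_of_mem s.2
  rcases (hconn s s.2).subset_or_subset hU hV hUV hs with h | h
  · left
    intro x hx
    rcases huv hx with h1 | h1
    · exact h1
    · exact absurd (hvV h1) (disjoint_left.1 hUV (h (hsub hx)))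
  · right
    intro x hx
    rcases huv hx with h1 | h1
    · exact absurd (h (hsub hx)) (disjoint_left.1 hUV (huU h1))
    · exact h1

theorem aux_irred {X ι : Type*} [MetricSpace X] (K : Set X) (hK : IsCompact K)
    (hKc : IsPreconnected K) (A : ι → X) (hA : ∀ j, A j ∈ K) :
    ∃ M ⊆ K, IsCompact M ∧ IsPreconnected M ∧ (∀ j, A j ∈ M) ∧
      ∀ N ⊆ M, IsClosed N → IsPreconnected N → (∀ j, A j ∈ N) → M ⊆ N := by
  obtain ⟨M, hMK, hM⟩ := zorn_superset_nonempty
    {S : Set X | IsCompact S ∧ IsPreconnected S ∧ ∀ j, A j ∈ S} (by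
      intro c hcS hc hne
      refine ⟨⋂₀ c, ⟨?_, aux_chain c hne hc (fun s hs => (hcS hs).1) (fun s hs => (hcS hs).2.1),
        fun j => mem_sInter.2 fun s hs => (hcS hs).2.2 j⟩, fun s hs => sInter_subset_of_mem hs⟩
      obtain ⟨s, hs⟩ := hne
      exact (hcS hs).1.of_isClosed_subset (isClosed_sInter fun s hs => (hcS hs).1.isClosed)
        (sInter_subset_of_mem hs)) K ⟨hK, hKc, hA⟩
  refine ⟨M, hMK, hM.1.1, hM.1.2.1, hM.1.2.2, ?_⟩
  intro N hN hNc hNp hNA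
  exact hM.2 ⟨hM.1.1.of_isClosed_subset hNc hN, hNp, hNA⟩ hN

theorem aux_bump {X : Type*} [MetricSpace X] (K : Set X) (hK : IsCompact K)
    (hKc : IsPreconnected K) (f : X → ℝ) (hf : Continuous f) (a b : X) (ha : a ∈ K) (hb : b ∈ K)
    (t : ℝ) (hbt : f b < t) (hta : t ≤ f a) :
    ∃ x ∈ connectedComponentIn (K ∩ {x | t ≤ f x}) a, f x = t := by
  set F := K ∩ {x | t ≤ f x} with hF
  have haF : a ∈ F := ⟨ha, hta⟩
  have hFc : IsCompact F := hK.inter_right (isClosed_le continuous_const hf)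
  have : CompactSpace F := isCompact_iff_compactSpace.1 hFc
  rw [connectedComponentIn_eq_image haF]
  by_contra hcon
  push Not at hcon
  set T : Set F := {x | f x = t} with hT
  have hTcl : IsClosed T := isClosed_eq (hf.comp continuous_subtype_val) continuous_const
  have hemp : T ∩ ⋂ s : { s : Set F // IsClopen s ∧ (⟨a, haF⟩ : F) ∈ s }, (s : Set F) = ∅ := by
    rw [← connectedComponent_eq_iInter_isClopen]
    ext x
    simp only [mem_inter_iff, mem_empty_iff_false, iff_false, not_and]
    intro hx hx2
    exact hcon x ⟨x, hx2, rfl⟩ hx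
  have : Nonempty { s : Set F // IsClopen s ∧ (⟨a, haF⟩ : F) ∈ s } := ⟨⟨univ, isClopen_univ, trivial⟩⟩
  obtain ⟨⟨Q, hQ, haQ⟩, hTQ⟩ := hTcl.isCompact.elim_directed_family_closed _
    (fun s => s.2.1.1) hemp (by
      intro s1 s2
      exact ⟨⟨s1 ∩ s2, s1.2.1.inter s2.2.1, s1.2.2, s2.2.2⟩, inter_subset_left, inter_subset_right⟩)
  rw [isPreconnected_closed_iff] at hKc
  have hFcl := hFc.isClosed
  obtain ⟨x, hxK, hx1, hx2⟩ := hKc (Subtype.val '' Q) (Subtype.val '' Qᶜ ∪ {x | f x ≤ t})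
    (hFcl.isClosedEmbedding_subtypeVal.isClosedMap _ hQ.1)
    ((hFcl.isClosedEmbedding_subtypeVal.isClosedMap _ hQ.compl.1).union
      (isClosed_le hf continuous_const)) (by
      intro x hx
      by_cases h : t ≤ f x
      · by_cases hq : (⟨x, hx, h⟩ : F) ∈ Q
        · exact Or.inl ⟨_, hq, rfl⟩
        · exact Or.inr (Or.inl ⟨_, hq, rfl⟩)
      · exact Or.inr (Or.inr (le_of_not_ge h))) ⟨a, ha, _, haQ, rfl⟩ ⟨b, hb, Or.inr hbt.le⟩
  obtain ⟨z, hz, rfl⟩ := hx1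
  rcases hx2 with ⟨z', hz', h⟩ | h
  · have := Subtype.val_injective h
    subst this
    exact hz' hz
  · have : z ∈ T ∩ Q := ⟨le_antisymm h z.2.2, hz⟩
    rw [hTQ] at this
    exact this

theorem aux_cover {X : Type*} [MetricSpace X] (K : Set X) (hK : IsCompact K)
    (hKc : IsPreconnected K) (f : X → ℝ) (hf : Continuous f) (a b : X) (ha : a ∈ K) (hb : b ∈ K)
    (t : ℝ) (hbt : f b < t) :
    Icc t (f a) ⊆ f '' connectedComponentIn (K ∩ {x | t ≤ f x}) a := by
  rcases le_or_gt t (f a) with h | h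
  · obtain ⟨x, hx, hxt⟩ := aux_bump K hK hKc f hf a b ha hb t hbt h
    have := isPreconnected_connectedComponentIn.intermediate_value hx
      (mem_connectedComponentIn (x := a) ⟨ha, h⟩) hf.continuousOn
    rwa [hxt] at this
  · rw [Icc_eq_empty (not_le.2 h)]; exact empty_subset _

theorem aux_comp_closed {X : Type*} [MetricSpace X] (F : Set X) (hF : IsCompact F) (a : X) :
    IsCompact (connectedComponentIn F a) := by
  by_cases h : a ∈ F
  · refine hF.of_isClosed_subset ?_ (connectedComponentIn_subset F a)
    rw [connectedComponentIn_eq_image h]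
    exact hF.isClosed.isClosedEmbedding_subtypeVal.isClosedMap _ isClosed_connectedComponent
  · rw [connectedComponentIn_eq_empty h]; exact isCompact_empty

/-- The tripod lemma. -/
theorem aux_tripod {X : Type*} [MetricSpace X] (K : Set X) (hK : IsCompact K)
    (hKc : IsPreconnected K) (f : Fin 3 → X → ℝ) (hf : ∀ j, Continuous (f j)) (A : Fin 3 → X)
    (hA : ∀ j, A j ∈ K) (ε : ℝ) (hε : 0 < ε) :
    ∃ C : Fin 3 → Set X, ∃ b ∈ K, (∀ j, IsCompact (C j)) ∧ (∀ j, C j ⊆ K) ∧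
      (∀ i j, i ≠ j → Disjoint (C i) (C j)) ∧
      ∀ j, Icc (f j b + ε) (f j (A j)) ⊆ f j '' C j := by
  obtain ⟨M, hMK, hM, hMc, hMA, hmin⟩ := aux_irred K hK hKc A hA
  set D : X → ℝ → Fin 3 → Set X := fun b e j =>
    connectedComponentIn (M ∩ {x | f j b + e ≤ f j x}) (A j) with hD
  have hDc : ∀ b e j, IsCompact (D b e j) := fun b e j =>
    aux_comp_closed _ (hM.inter_right (isClosed_le continuous_const (hf j))) _
  have hDM : ∀ b e j, D b e j ⊆ M ∩ {x | f j b + e ≤ f j x} := fun b e j =>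
    connectedComponentIn_subset _ _
  have hDA : ∀ b e j, (D b e j).Nonempty → A j ∈ D b e j := fun b e j h =>
    mem_connectedComponentIn (connectedComponentIn_nonempty_iff.1 h)
  -- if two different pairs meet we contradict irreducibility
  have huniq : ∀ b ∈ M, ∀ e > 0, ∀ i j k, i ≠ j → k ≠ i → k ≠ j →
      (D b e i ∩ D b e j).Nonempty → (D b e i ∩ D b e k).Nonempty → False := by
    intro b hb e he i j k hij hki hkj h1 h2
    have hp1 : IsPreconnected (D b e i ∪ D b e j) :=
      isPreconnected_connectedComponentIn.union' h1 isPreconnected_connectedComponentIn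
    have hp2 : IsPreconnected ((D b e i ∪ D b e j) ∪ D b e k) :=
      hp1.union' (h2.mono (inter_subset_inter_left _ subset_union_left))
        isPreconnected_connectedComponentIn
    have hin : ∀ l : Fin 3, l = i ∨ l = j ∨ l = k := by omega
    have hb' := hmin _ (union_subset (union_subset ((hDM b e i).trans inter_subset_left)
      ((hDM b e j).trans inter_subset_left)) ((hDM b e k).trans inter_subset_left))
      (((hDc b e i).union (hDc b e j)).union (hDc b e k)).isClosed hp2 (by
        intro l
        rcases hin l with rfl | rfl | rfl
        · exact Or.inl (Or.inl (hDA _ _ _ (h1.mono inter_subset_left)))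
        · exact Or.inl (Or.inr (hDA _ _ _ (h1.mono inter_subset_right)))
        · exact Or.inr (hDA _ _ _ (h2.mono inter_subset_right))) hb
    have hno : ∀ l, b ∉ D b e l := by
      intro l hl
      have := (hDM b e l hl).2
      simp only [mem_ofPred_eq] at this
      linarith
    rcases hb' with (h | h) | h <;> exact hno _ h
  -- P b e l : the pair complementary to l meets
  set P : X → ℝ → Fin 3 → Prop := fun b e l => (D b e (l+1) ∩ D b e (l+2)).Nonempty with hP
  have huniqP : ∀ b ∈ M, ∀ e > 0, ∀ l m, P b e l → P b e m → l = m := by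
    intro b hb e he l m hl hm
    by_contra hne
    simp only [hP] at hl hm
    have hl' := hl
    have hm' := hm
    rw [inter_comm] at hl' hm'
    have : m = l + 1 ∨ m = l + 2 := by omega
    rcases this with h | h
    · subst h
      have e1 : l + 1 + 1 = l + 2 := by omega
      have e2 : l + 1 + 2 = l := by omega
      rw [e1, e2] at hm
      exact huniq b hb e he (l+2) (l+1) l (by omega) (by omega) (by omega) hl' hm
    · subst h
      have e1 : l + 2 + 1 = l := by omega
      have e2 : l + 2 + 2 = l + 1 := by omega
      rw [e1, e2] at hm'
      exact huniq b hb e he (l+1) (l+2) l (by omega) (by omega) (by omega) hl hm'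
  have hPA : ∀ e > 0, ∀ j l, j ≠ l → ¬ P (A j) e l := by
    intro e he j l hjl h
    have hemp : ¬ (D (A j) e j).Nonempty := by
      intro hn
      have := (hDM _ _ _ (hDA _ _ _ hn)).2
      simp only [mem_ofPred_eq] at this
      linarith
    have : j = l + 1 ∨ j = l + 2 := by omega
    rcases this with h' | h'
    · subst h'; exact hemp (h.mono inter_subset_left)
    · subst h'; exact hemp (h.mono inter_subset_right)
  have hex : ∃ b ∈ M, ∀ l, ¬ P b ε l := by
    by_contra hcon
    push Not at hcon
    choose! p hp using hcon
    have : PreconnectedSpace M := isPreconnected_iff_preconnectedSpace.1 hMc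
    have hloc : IsLocallyConstant (fun x : M => p x) := by
      rw [IsLocallyConstant.iff_eventually_eq]
      intro x
      have hev : ∀ᶠ y : M in 𝓝 x, ∀ j, f j y < f j x + ε / 2 := by
        rw [eventually_all]
        intro j
        have hc : Continuous (fun y : M => f j y) := (hf j).comp continuous_subtype_val
        exact hc.continuousAt.eventually_lt continuousAt_const (by linarith)
      filter_upwards [hev] with y hy
      have hmono : ∀ j, D x ε j ⊆ D y (ε/2) j := by
        intro j
        refine connectedComponentIn_mono _ (inter_subset_inter_right _ ?_)
        intro z hz
        simp only [mem_ofPred_eq] at hz ⊢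
        linarith [hy j]
      have hmono2 : ∀ j, D y ε j ⊆ D y (ε/2) j := by
        intro j
        refine connectedComponentIn_mono _ (inter_subset_inter_right _ ?_)
        intro z hz
        simp only [mem_ofPred_eq] at hz ⊢
        linarith
      exact huniqP y y.2 (ε/2) (by linarith) _ _
        ((hp y y.2).mono (inter_subset_inter (hmono2 _) (hmono2 _)))
        ((hp x x.2).mono (inter_subset_inter (hmono _) (hmono _)))
    have h01 := hloc.apply_eq_of_preconnectedSpace ⟨A 0, hMA 0⟩ ⟨A 1, hMA 1⟩
    have h0 : p (A 0) = 0 := by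
      by_contra h
      exact hPA ε hε 0 _ (Ne.symm h) (hp _ (hMA 0))
    have h1 : p (A 1) = 1 := by
      by_contra h
      exact hPA ε hε 1 _ (Ne.symm h) (hp _ (hMA 1))
    simp only [h0, h1] at h01
    exact absurd h01 (by decide)
  obtain ⟨b, hb, hbP⟩ := hex
  refine ⟨D b ε, b, hMK hb, hDc b ε, fun j => (hDM b ε j).trans (inter_subset_left.trans hMK), ?_,
    fun j => aux_cover M hM hMc (f j) (hf j) (A j) b (hMA j) hb _ (by linarith)⟩
  intro i j hij
  rw [disjoint_iff_inter_eq_empty, ← not_nonempty_iff_eq_empty]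
  intro hn
  have : ∃ l : Fin 3, (i = l + 1 ∧ j = l + 2) ∨ (j = l + 1 ∧ i = l + 2) := by
    revert hij; clear hn; revert i j; decide
  obtain ⟨l, ⟨rfl, rfl⟩ | ⟨rfl, rfl⟩⟩ := this
  · exact hbP l hn
  · rw [inter_comm] at hn; exact hbP l hn

theorem aux_family {X ι : Type*} [MetricSpace X] [SecondCountableTopology X] [Fintype ι] :
    ∃ U : ℕ → ι → Set X, (∀ n j, IsClosed (U n j)) ∧
      (∀ n i j, i ≠ j → Disjoint (U n i) (U n j)) ∧
      ∀ C : ι → Set X, (∀ j, IsCompact (C j)) → (∀ i j, i ≠ j → Disjoint (C i) (C j)) →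
        ∃ n, ∀ j, C j ⊆ U n j := by
  classical
  set B := TopologicalSpace.countableBasis X with hB
  have hBb : TopologicalSpace.IsTopologicalBasis B := TopologicalSpace.isBasis_countableBasis X
  set Fam : Set (Set X) := (fun s : Set (Set X) => closure (⋃₀ s)) '' {s | s.Finite ∧ s ⊆ B} with hFam
  have hFamc : Fam.Countable :=
    (Set.countable_ofPred_finite_subset (TopologicalSpace.countable_countableBasis X)).image _
  set W : Set (ι → Set X) := {U | (∀ j, U j ∈ Fam) ∧ ∀ i j, i ≠ j → Disjoint (U i) (U j)} with hW
  have hWc : W.Countable := by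
    have h := Set.countable_pi (fun _ : ι => hFamc)
    exact h.mono fun U hU => hU.1
  have hWne : W.Nonempty := ⟨fun _ => ∅, fun j => ⟨∅, ⟨finite_empty, empty_subset _⟩, by simp⟩,
    fun i j _ => by simp⟩
  obtain ⟨U, hU⟩ := hWc.exists_eq_range hWne
  have hUW : ∀ n, U n ∈ W := fun n => hU ▸ mem_range_self n
  refine ⟨U, ?_, fun n => (hUW n).2, ?_⟩
  · intro n j
    obtain ⟨s, -, hs⟩ := (hUW n).1 j
    rw [← hs]
    exact isClosed_closure
  · intro C hC hd
    have h1 : ∀ i j, ∃ δ > 0, i ≠ j → Disjoint (cthickening δ (C i)) (cthickening δ (C j)) := by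
      intro i j
      by_cases h : i = j
      · exact ⟨1, one_pos, fun h' => absurd h h'⟩
      · obtain ⟨δ, hδ, hh⟩ := (hd i j h).exists_cthickenings (hC i) (hC j).isClosed
        exact ⟨δ, hδ, fun _ => hh⟩
    choose δ hδ hδd using h1
    obtain ⟨η, hη, hηle⟩ : ∃ η > 0, ∀ i j, η ≤ δ i j := by
      have hfin : (range fun p : ι × ι => δ p.1 p.2).Finite := finite_range _
      have hev : ∀ᶠ η in 𝓝[>] (0:ℝ), ∀ p : ι × ι, η ≤ δ p.1 p.2 := by
        rw [eventually_all]
        intro p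
        exact nhdsWithin_le_nhds (eventually_le_nhds (hδ p.1 p.2))
      obtain ⟨η, hη1, hη2⟩ := (hev.and self_mem_nhdsWithin).exists
      exact ⟨η, hη2, fun i j => hη1 (i, j)⟩
    have h2 : ∀ j, ∃ s : Set (Set X), (s.Finite ∧ s ⊆ B) ∧ C j ⊆ ⋃₀ s ∧ ⋃₀ s ⊆ thickening η (C j) := by
      intro j
      have hopen : IsOpen (thickening η (C j)) := isOpen_thickening
      have heq := hBb.open_eq_sUnion' hopen
      obtain ⟨b', hb', hfin, hcov⟩ := (hC j).elim_finite_subcover_image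
        (b := {s | s ∈ B ∧ s ⊆ thickening η (C j)}) (c := id)
        (fun s hs => hBb.isOpen hs.1) (by
          have hself := self_subset_thickening hη (C j)
          rw [heq, sUnion_eq_biUnion] at hself
          exact hself)
      refine ⟨b', ⟨hfin, fun s hs => (hb' hs).1⟩, ?_, sUnion_subset fun s hs => (hb' hs).2⟩
      rw [sUnion_eq_biUnion]
      exact hcov
    choose s hs hCs hsT using h2
    have hmem : (fun j => closure (⋃₀ s j)) ∈ W := by
      refine ⟨fun j => ⟨s j, hs j, rfl⟩, fun i j hij => ?_⟩
      refine (hδd i j hij).mono ?_ ?_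
      · refine (closure_mono (hsT i)).trans ((closure_thickening_subset_cthickening _ _).trans
          (cthickening_mono (hηle i j) _))
      · refine (closure_mono (hsT j)).trans ((closure_thickening_subset_cthickening _ _).trans
          (cthickening_mono (hηle i j) _))
    rw [hU] at hmem
    obtain ⟨n, hn⟩ := hmem
    refine ⟨n, fun j => ?_⟩
    rw [hn]
    exact (hCs j).trans subset_closure

abbrev E2' := EuclideanSpace ℝ (Fin 2)

theorem aux_fubini : ∃ c : ℝ≥0∞, ∀ D : Set E2', MeasurableSet D →
    Measurable (fun y : ℝ => volume {s : ℝ | (!₂[s, y] : E2') ∈ D}) ∧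
    μH[2] D = c * ∫⁻ y : ℝ, volume {s : ℝ | (!₂[s, y] : E2') ∈ D} := by
  have hh : Measure.IsAddHaarMeasure (G := E2') μH[2] := by
    have := MeasureTheory.isAddHaarMeasure_hausdorffMeasure (E := E2')
    simpa using this
  have hsm := Measure.isAddLeftInvariant_eq_smul (μH[2] : Measure E2') volume
  refine ⟨(Measure.addHaarScalarFactor (μH[2] : Measure E2') volume : ℝ≥0∞), fun D hD => ?_⟩
  set φ : ℝ × ℝ → E2' := fun p => !₂[p.1, p.2] with hφ
  have hmp : MeasurePreserving φ volume volume := by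
    have h1 := (volume_preserving_finTwoArrow ℝ).symm
    have h2 := PiLp.volume_preserving_toLp (Fin 2)
    have := h2.comp h1
    convert! this using 1
  have hpre : MeasurableSet (φ ⁻¹' D) := hmp.measurable hD
  refine ⟨measurable_measure_prodMk_right hpre, ?_⟩
  conv_lhs => rw [hsm]
  rw [Measure.smul_apply, ENNReal.smul_def, smul_eq_mul, ← hmp.measure_preimage hD.nullMeasurableSet, Measure.volume_eq_prod,
    Measure.prod_apply_symm hpre]
  rfl

def PW (w : E3) (x : E3) : E2' := !₂[⟪w, x⟫, x 2]

theorem PW_lip (w : E3) (hw : ‖w‖ = 1) (hw2 : w 2 = 0) : LipschitzWith 1 (PW w) := by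
  refine LipschitzWith.of_dist_le_mul fun x y => ?_
  rw [EuclideanSpace.dist_eq, EuclideanSpace.dist_eq, NNReal.coe_one, one_mul]
  apply Real.sqrt_le_sqrt
  have hn : w 0 ^ 2 + w 1 ^ 2 = 1 := by
    have := EuclideanSpace.norm_sq_eq w
    rw [hw] at this
    simp [Fin.sum_univ_three, hw2] at this
    linarith
  simp only [PW, Fin.sum_univ_two, Fin.sum_univ_three, Real.dist_eq, sq_abs, PiLp.inner_apply]
  simp [hw2]
  nlinarith [sq_nonneg (w 0 * (x 1 - y 1) - w 1 * (x 0 - y 0))]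

theorem PW_slice (w : E3) (S : Set E3) (y : ℝ) :
    {s : ℝ | (!₂[s, y] : E2') ∈ PW w '' S} = {s | ∃ x ∈ S, x 2 = y ∧ ⟪w, x⟫ = s} := by
  ext s
  simp only [mem_ofPred_eq, mem_image, PW]
  refine exists_congr fun x => and_congr_right fun _ => ?_
  constructor
  · intro h
    have h0 := congrArg (fun p : E2' => p 0) h
    have h1 := congrArg (fun p : E2' => p 1) h
    simp at h0 h1
    exact ⟨h1, h0⟩
  · rintro ⟨rfl, rfl⟩
    rfl

theorem aux_master {ι : Type*} [Fintype ι] (c : ℝ≥0∞)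
    (hc : ∀ D : Set E2', MeasurableSet D →
      Measurable (fun y : ℝ => volume {s : ℝ | (!₂[s, y] : E2') ∈ D}) ∧
      μH[2] D = c * ∫⁻ y : ℝ, volume {s : ℝ | (!₂[s, y] : E2') ∈ D})
    (S : Set E3) (hS : IsCompact S) (w : ι → E3) (hw : ∀ j, ‖w j‖ = 1 ∧ w j 2 = 0)
    (U : ℕ → ι → Set E3) (hU : ∀ n j, IsClosed (U n j))
    (hUd : ∀ n i j, i ≠ j → Disjoint (U n i) (U n j)) (B : Set ℝ) (hB : MeasurableSet B)
    (G : ℝ → ℝ≥0∞)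
    (hG : ∀ᵐ y ∂(volume.restrict B), G y ≤
      ⨆ n, ∑ j, volume {s : ℝ | ∃ x ∈ S ∩ U n j, x 2 = y ∧ ⟪w j, x⟫ = s}) :
    c * ∫⁻ y in B, G y ≤ μH[2] (S ∩ {x : E3 | x 2 ∈ B}) := by
  have hm2 : Measurable (fun x : E3 => x 2) := by fun_prop
  set ν : Measure ℝ := (μH[2].restrict S).map (fun x : E3 => x 2) with hν
  have hνB : ∀ A, MeasurableSet A → ν A = μH[2] (S ∩ {x : E3 | x 2 ∈ A}) := by
    intro A hA
    rw [hν, Measure.map_apply hm2 hA, Measure.restrict_apply (hm2 hA), inter_comm]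
    rfl
  set F0 : ℕ → ι → ℝ → ℝ≥0∞ := fun n j y =>
    volume {s : ℝ | ∃ x ∈ S ∩ U n j, x 2 = y ∧ ⟪w j, x⟫ = s} with hF0
  have hcomp : ∀ n j, IsCompact (S ∩ U n j) := fun n j => hS.inter_right (hU n j)
  have himg : ∀ n j, MeasurableSet (PW (w j) '' (S ∩ U n j)) := fun n j =>
    ((hcomp n j).image (PW_lip _ (hw j).1 (hw j).2).continuous).measurableSet
  have hF0m : ∀ n j, Measurable (F0 n j) := by
    intro n j
    have := (hc _ (himg n j)).1
    simp only [PW_slice] at this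
    exact this
  have hF0le : ∀ n j A, MeasurableSet A →
      c * ∫⁻ y in A, F0 n j y ≤ μH[2] (S ∩ U n j ∩ {x : E3 | x 2 ∈ A}) := by
    intro n j A hA
    have hm1 : Measurable (fun p : E2' => p 1) := by fun_prop
    have heq : PW (w j) '' (S ∩ U n j ∩ {x : E3 | x 2 ∈ A}) =
        PW (w j) '' (S ∩ U n j) ∩ {p : E2' | p 1 ∈ A} := by
      ext p
      constructor
      · rintro ⟨x, ⟨hx, hxA⟩, rfl⟩
        exact ⟨⟨x, hx, rfl⟩, hxA⟩
      · rintro ⟨⟨x, hx, rfl⟩, hxA⟩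
        exact ⟨x, ⟨hx, hxA⟩, rfl⟩
    have hmeas : MeasurableSet (PW (w j) '' (S ∩ U n j ∩ {x : E3 | x 2 ∈ A})) := by
      rw [heq]; exact (himg n j).inter (hm1 hA)
    have hle := (PW_lip _ (hw j).1 (hw j).2).hausdorffMeasure_image_le (d := 2) (by norm_num)
      (S ∩ U n j ∩ {x : E3 | x 2 ∈ A})
    rw [ENNReal.coe_one, ENNReal.one_rpow, one_mul, (hc _ hmeas).2] at hle
    refine le_trans ?_ hle
    gcongr 1
    rw [← lintegral_indicator hA]
    refine lintegral_mono fun y => ?_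
    rw [PW_slice]
    by_cases hy : y ∈ A
    · rw [indicator_of_mem hy]
      refine measure_mono ?_
      rintro s ⟨x, hx, hxy, hs⟩
      refine ⟨x, ⟨hx, ?_⟩, hxy, hs⟩
      simpa [hxy] using hy
    · rw [indicator_of_notMem hy]; exact zero_le
  set F : ℕ → ℝ → ℝ≥0∞ := fun n y => c * ∑ j, F0 n j y with hF
  have hFm : ∀ n, Measurable (F n) := fun n =>
    (Finset.measurable_fun_sum _ fun j _ => hF0m n j).const_mul _
  have hFle : ∀ n, F n ∈ Measure.LebesgueDecomposition.measurableLE volume ν := by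
    intro n
    refine ⟨hFm n, fun A hA => ?_⟩
    rw [hνB A hA]
    simp only [hF]
    rw [lintegral_const_mul _ (Finset.measurable_fun_sum _ fun j _ => hF0m n j),
      lintegral_finsetSum _ (fun j _ => hF0m n j), Finset.mul_sum]
    calc ∑ j, c * ∫⁻ y in A, F0 n j y ≤ ∑ j, μH[2] (S ∩ U n j ∩ {x : E3 | x 2 ∈ A}) :=
          Finset.sum_le_sum fun j _ => hF0le n j A hA
      _ = μH[2] (⋃ j, S ∩ U n j ∩ {x : E3 | x 2 ∈ A}) := by
          rw [measure_iUnion, tsum_fintype]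
          · intro i j hij
            refine (hUd n i j hij).mono ?_ ?_ <;> exact fun x hx => hx.1.2
          · intro j
            exact (hcomp n j).measurableSet.inter (hm2 hA)
      _ ≤ _ := measure_mono (iUnion_subset fun j => fun x hx => And.intro hx.1.1 hx.2)
  rw [← hνB B hB]
  calc c * ∫⁻ y in B, G y ≤ c * ∫⁻ y in B, ⨆ n, ∑ j, F0 n j y := by
        gcongr 1
        exact lintegral_mono_ae hG
    _ ≤ ∫⁻ y in B, ⨆ n, ⨆ k, ⨆ (_ : k ≤ n), F k y := by
        rw [← lintegral_const_mul]
        · refine lintegral_mono fun y => ?_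
          simp only
          rw [ENNReal.mul_iSup]
          refine iSup_le fun n => ?_
          exact le_iSup_of_le n (le_iSup₂_of_le n le_rfl le_rfl)
        · exact Measurable.iSup fun n => Finset.measurable_fun_sum _ fun j _ => hF0m n j
    _ ≤ ν B := by
        rw [lintegral_iSup
          (fun n => (Measure.LebesgueDecomposition.iSup_mem_measurableLE _ hFle n).1)
          (Measure.LebesgueDecomposition.iSup_monotone _)]
        exact iSup_le fun n =>
          (Measure.LebesgueDecomposition.iSup_mem_measurableLE _ hFle n).2 B hB

def eV : E3 := EuclideanSpace.single (2 : Fin 3) (1:ℝ)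

theorem eV_two : eV 2 = 1 := by simp [eV]
theorem eV_zero : eV 0 = 0 := by simp [eV]
theorem eV_one : eV 1 = 0 := by simp [eV]

theorem aux_normsq (x : E3) : ‖x‖ ^ 2 = x 0 ^ 2 + x 1 ^ 2 + x 2 ^ 2 := by
  rw [EuclideanSpace.norm_sq_eq]; simp [Fin.sum_univ_three]

theorem aux_normsq_comb (h : E3) (h2 : h 2 = 0) (y : ℝ) : ‖h + y • eV‖ ^ 2 = ‖h‖ ^ 2 + y ^ 2 := by
  rw [aux_normsq, aux_normsq]
  simp [eV_two, eV_zero, eV_one, h2]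

theorem aux_zside (c : ℝ≥0∞)
    (hc : ∀ D : Set E2', MeasurableSet D →
      Measurable (fun y : ℝ => volume {s : ℝ | (!₂[s, y] : E2') ∈ D}) ∧
      μH[2] D = c * ∫⁻ y : ℝ, volume {s : ℝ | (!₂[s, y] : E2') ∈ D})
    (w : E3) (hw : ‖w‖ = 1) (hw2 : w 2 = 0) (ρ : ℝ) (hρ : 0 < ρ) :
    μH[2] (({p : E3 | ∃ a b : ℝ, 0 ≤ a ∧ 0 ≤ b ∧ p = a • w + b • eV} ∩ closedBall 0 ρ) \ Plane3) ≤
      c * ∫⁻ y in Ioo 0 ρ, ENNReal.ofReal (√(ρ ^ 2 - y ^ 2)) := by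
  set D : Set E2' := {p | 0 ≤ p 0 ∧ 0 < p 1 ∧ p 0 ^ 2 + p 1 ^ 2 ≤ ρ ^ 2} with hD
  have m0 : Measurable (fun p : E2' => p 0) := by fun_prop
  have m1 : Measurable (fun p : E2' => p 1) := by fun_prop
  have hDm : MeasurableSet D := by
    refine (measurableSet_le measurable_const m0).inter
      ((measurableSet_lt measurable_const m1).inter
      (measurableSet_le ((m0.pow_const 2).add (m1.pow_const 2)) measurable_const))
  set ψ : E2' → E3 := fun p => p 0 • w + p 1 • eV with hψ
  have hψl : LipschitzWith 1 ψ := by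
    refine LipschitzWith.of_dist_le_mul fun x y => ?_
    rw [NNReal.coe_one, one_mul, dist_eq_norm, EuclideanSpace.dist_eq]
    apply Real.le_sqrt_of_sq_le
    have : ψ x - ψ y = (x 0 - y 0) • w + (x 1 - y 1) • eV := by
      simp only [hψ]; module
    rw [this, aux_normsq_comb _ (by simp [hw2]), norm_smul, hw]
    simp [Fin.sum_univ_two, Real.dist_eq]
  have hle := hψl.hausdorffMeasure_image_le (d := 2) (by norm_num) D
  rw [ENNReal.coe_one, ENNReal.one_rpow, one_mul, (hc _ hDm).2] at hle
  refine (measure_mono ?_).trans (hle.trans ?_)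
  · rintro p ⟨⟨⟨a, b, ha, hb, rfl⟩, hball⟩, hpl⟩
    have hb0 : b ≠ 0 := by
      intro h
      apply hpl
      simp [Plane3, h, hw2]
    rw [mem_closedBall_zero_iff] at hball
    have h2 : ‖a • w + b • eV‖ ^ 2 ≤ ρ ^ 2 := by gcongr
    rw [aux_normsq_comb _ (by simp [hw2]), norm_smul, hw] at h2
    simp at h2
    refine ⟨!₂[a, b], ⟨by simpa using ha, by simpa using lt_of_le_of_ne hb hb0.symm, by simpa using h2⟩, ?_⟩
    simp [hψ]
  · gcongr 1
    rw [← lintegral_indicator measurableSet_Ioo]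
    refine lintegral_mono fun y => ?_
    by_cases hy : y ∈ Ioo 0 ρ
    · rw [indicator_of_mem hy]
      calc volume {s : ℝ | (!₂[s, y] : E2') ∈ D} ≤ volume (Icc 0 (√(ρ ^ 2 - y ^ 2))) := by
            refine measure_mono ?_
            rintro s ⟨h1, h2, h3⟩
            simp at h1 h2 h3
            exact ⟨h1, Real.le_sqrt_of_sq_le (by linarith)⟩
        _ = _ := by rw [Real.volume_Icc, sub_zero]
    · rw [indicator_of_notMem hy]
      calc volume {s : ℝ | (!₂[s, y] : E2') ∈ D} ≤ volume ({0} : Set ℝ) := by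
            refine measure_mono ?_
            rintro s ⟨h1, h2, h3⟩
            simp at h1 h2 h3
            have hy' : ρ ≤ y := by
              by_contra h
              exact hy ⟨h2, not_le.1 h⟩
            have : s ^ 2 ≤ 0 := by nlinarith
            have : s = 0 := by nlinarith
            exact this
        _ ≤ _ := by simp

theorem aux_star {ι : Type*} [Fintype ι] (w : ι → E3) (hw : ∀ j, ‖w j‖ = 1 ∧ w j 2 = 0)
    (H : ∀ K : Set E3, IsCompact K → IsPreconnected K → ∀ R > 0, ∀ y : ℝ,
      (∀ j, R • w j + y • eV ∈ K) → ∀ ε > 0, ∃ C : ι → Set E3, ∃ b : ι → ℝ, ∑ j, b j = 0 ∧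
        (∀ j, IsCompact (C j)) ∧ (∀ j, C j ⊆ K) ∧ (∀ i j, i ≠ j → Disjoint (C i) (C j)) ∧
        ∀ j, Icc (b j + ε) R ⊆ (fun x : E3 => ⟪w j, x⟫) '' C j)
    (Z' E : Set E3)
    (hZ : Z' = ⋃ j, {p : E3 | ∃ a c : ℝ, 0 ≤ a ∧ 0 ≤ c ∧ p = a • w j + c • eV})
    (r : ℝ) (hr : 0 < r) (hEcl : IsClosed E)
    (hout : ∀ x : E3, x ∉ ball (0:E3) (r/2) → (x ∈ E ↔ x ∈ Z' ∪ Plane3))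
    (hslice : ∀ᵐ y ∂(volume.restrict (Set.Ioo (0:ℝ) r)), IsConnected {x : E3 | x ∈ E ∧ x 2 = y}) :
    μH[2] (((Z' ∪ Plane3) ∩ ball (0:E3) r) \ Plane3) ≤
      μH[2] ((E ∩ ball (0:E3) r) \ Plane3) := by
  obtain ⟨c, hc⟩ := aux_fubini
  have hww : ∀ j, ⟪w j, w j⟫ = 1 := fun j => by rw [real_inner_self_eq_norm_sq, (hw j).1]; norm_num
  have hweV : ∀ j, ⟪w j, eV⟫ = 0 := fun j => by
    simp [PiLp.inner_apply, Fin.sum_univ_three, eV_two, eV_zero, eV_one, (hw j).2]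
  have main : ∀ ρ, r / 2 < ρ → ρ < r →
      μH[2] ((Z' ∩ closedBall 0 ρ) \ Plane3) ≤ μH[2] ((E ∩ ball (0:E3) r) \ Plane3) := by
    intro ρ hρ1 hρ2
    have hρ : 0 < ρ := by linarith
    set S := E ∩ closedBall (0:E3) ρ with hS
    have hSc : IsCompact S := (isCompact_closedBall 0 ρ).inter_left hEcl
    obtain ⟨U, hUc, hUd, hUC⟩ := aux_family (X := E3) (ι := ι)
    have key : ∀ᵐ y ∂(volume.restrict (Ioo 0 ρ)),
        (Fintype.card ι : ℝ≥0∞) * ENNReal.ofReal (√(ρ ^ 2 - y ^ 2)) ≤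
        ⨆ n, ∑ j, volume {s : ℝ | ∃ x ∈ S ∩ U n j, x 2 = y ∧ ⟪w j, x⟫ = s} := by
      have h1 := ae_restrict_of_ae_restrict_of_subset
        (Ioo_subset_Ioo_right hρ2.le : Ioo 0 ρ ⊆ Ioo 0 r) hslice
      filter_upwards [h1, ae_restrict_mem measurableSet_Ioo] with y hconn hy
      set R := √(ρ ^ 2 - y ^ 2) with hR
      have hpos : 0 < ρ ^ 2 - y ^ 2 := by nlinarith [hy.1, hy.2]
      have hRpos : 0 < R := Real.sqrt_pos.2 hpos
      have hRsq : R ^ 2 = ρ ^ 2 - y ^ 2 := Real.sq_sqrt hpos.le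
      set K := S ∩ {x : E3 | x 2 = y} with hK
      have hm2 : Continuous (fun x : E3 => x 2) := by fun_prop
      have hKcomp : IsCompact K := hSc.inter_right (isClosed_eq hm2 continuous_const)
      set q : E3 → E3 := fun x => (R / max R ‖x - y • eV‖) • (x - y • eV) + y • eV with hq
      have hqc : Continuous q := by
        have hmax : Continuous (fun x : E3 => max R ‖x - y • eV‖) := by fun_prop
        have hd : Continuous (fun x : E3 => R / max R ‖x - y • eV‖) :=
          continuous_const.div hmax fun x => (lt_of_lt_of_le hRpos (le_max_left _ _)).ne'
        exact (hd.smul (by fun_prop)).add continuous_const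
      -- points on the sphere
      have hsphere : ∀ x ∈ Z', ‖x‖ = ρ → x ∈ E := by
        intro x hx hxn
        refine (hout x ?_).2 (Or.inl hx)
        rw [mem_ball_zero_iff, hxn]; linarith
      have hA : ∀ j, R • w j + y • eV ∈ K := by
        intro j
        have hn : ‖R • w j + y • eV‖ = ρ := by
          have : ‖R • w j + y • eV‖ ^ 2 = ρ ^ 2 := by
            rw [aux_normsq_comb _ (by simp [(hw j).2]), norm_smul, (hw j).1]
            simp [hRsq]
          exact (pow_left_inj₀ (norm_nonneg _) hρ.le two_ne_zero).1 this
        refine ⟨⟨hsphere _ ?_ hn, by rw [mem_closedBall_zero_iff, hn]⟩, ?_⟩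
        · rw [hZ]
          exact mem_iUnion.2 ⟨j, R, y, hRpos.le, hy.1.le, rfl⟩
        · simp [(hw j).2, eV_two]
      have hKq : K = q '' {x : E3 | x ∈ E ∧ x 2 = y} := by
        have hx2 : ∀ x : E3, x 2 = y → (x - y • eV) 2 = 0 := by
          intro x hx; simp [hx, eV_two]
        have hnx : ∀ x : E3, x 2 = y → ‖x‖ ^ 2 = ‖x - y • eV‖ ^ 2 + y ^ 2 := by
          intro x hx
          rw [← aux_normsq_comb _ (hx2 x hx) y, sub_add_cancel]
        have hid : ∀ x : E3, ‖x - y • eV‖ ≤ R → q x = x := by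
          intro x hx
          simp only [hq]
          rw [max_eq_left hx, div_self hRpos.ne', one_smul, sub_add_cancel]
        ext z
        constructor
        · rintro ⟨⟨hzE, hzb⟩, hzy⟩
          refine ⟨z, ⟨hzE, hzy⟩, hid z ?_⟩
          rw [mem_closedBall_zero_iff] at hzb
          have h3 := hnx z hzy
          have h4 : ‖z‖ ^ 2 ≤ ρ ^ 2 := by gcongr
          exact Real.le_sqrt_of_sq_le (by linarith)
        · rintro ⟨x, ⟨hxE, hxy⟩, rfl⟩
          rcases le_or_gt ‖x - y • eV‖ R with h | h
          · rw [hid x h]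
            refine ⟨⟨hxE, ?_⟩, hxy⟩
            rw [mem_closedBall_zero_iff]
            have h3 := hnx x hxy
            refine (sq_le_sq₀ (norm_nonneg _) hρ.le).1 ?_
            have : ‖x - y • eV‖ ^ 2 ≤ R ^ 2 := by gcongr
            linarith
          · have h3 := hnx x hxy
            have h4 : R ^ 2 < ‖x - y • eV‖ ^ 2 := by gcongr
            have h5 : ρ < ‖x‖ := by
              refine lt_of_pow_lt_pow_left₀ 2 (norm_nonneg _) ?_
              linarith
            have hxZ : x ∈ Z' := by
              rcases (hout x (by rw [mem_ball_zero_iff]; linarith)).1 hxE with h6 | h6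
              · exact h6
              · exfalso
                have h7 : x 2 = 0 := h6
                linarith [hy.1]
            have hqx : ∃ j, q x = R • w j + y • eV := by
              rw [hZ] at hxZ
              obtain ⟨j, a, d, ha, hd, hxe⟩ := mem_iUnion.1 hxZ
              have hdy : d = y := by
                rw [← hxy, hxe]; simp [(hw j).2, eV_two]
              have hxa : x - y • eV = a • w j := by rw [hxe, hdy]; simp
              have hna : ‖x - y • eV‖ = a := by
                rw [hxa, norm_smul, (hw j).1, Real.norm_of_nonneg ha, mul_one]
              refine ⟨j, ?_⟩
              simp only [hq]
              rw [max_eq_right h.le, hna, hxa, smul_smul, div_mul_cancel₀]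
              rw [hna] at h
              linarith
            obtain ⟨j, hj⟩ := hqx
            rw [hj]
            exact hA j
      have hKconn : IsPreconnected K := by
        rw [hKq]
        exact hconn.isPreconnected.image q hqc.continuousOn
      have hstep : ∀ ε > 0, ENNReal.ofReal (Fintype.card ι * R - Fintype.card ι * ε) ≤
          ⨆ n, ∑ j, volume {s : ℝ | ∃ x ∈ S ∩ U n j, x 2 = y ∧ ⟪w j, x⟫ = s} := by
        intro ε hε
        obtain ⟨C, b, hb, hCc, hCK, hCd, hCcov⟩ := H K hKcomp hKconn R hRpos y hA ε hε
        obtain ⟨n, hn⟩ := hUC C hCc hCd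
        refine le_iSup_of_le n ?_
        have hsum : (Fintype.card ι * R - Fintype.card ι * ε : ℝ) = ∑ j, (R - (b j + ε)) := by
          simp [Finset.sum_sub_distrib, Finset.sum_add_distrib, hb]
        rw [hsum]
        calc ENNReal.ofReal (∑ j, (R - (b j + ε))) ≤ ENNReal.ofReal (∑ j, max (R - (b j + ε)) 0) := by
              gcongr; exact le_max_left _ _
          _ = ∑ j, ENNReal.ofReal (max (R - (b j + ε)) 0) :=
              ENNReal.ofReal_sum_of_nonneg fun j _ => le_max_right _ _
          _ ≤ _ := by
              refine Finset.sum_le_sum fun j _ => ?_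
              have : ENNReal.ofReal (max (R - (b j + ε)) 0) = volume (Icc (b j + ε) R) := by
                rw [Real.volume_Icc, ENNReal.ofReal_max]
                simp
              rw [this]
              refine measure_mono fun s hs => ?_
              obtain ⟨x, hx, hxs⟩ := hCcov j hs
              exact ⟨x, ⟨(hCK j hx).1, hn j hx⟩, (hCK j hx).2, hxs⟩
      have hlim : Tendsto (fun ε : ℝ => ENNReal.ofReal (Fintype.card ι * R - Fintype.card ι * ε))
          (𝓝[>] 0) (𝓝 (ENNReal.ofReal (Fintype.card ι * R - Fintype.card ι * 0))) := by
        refine (ENNReal.continuous_ofReal.comp ?_).continuousAt.mono_left nhdsWithin_le_nhds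
        fun_prop
      have := le_of_tendsto hlim (eventually_nhdsWithin_of_forall fun ε hε => hstep ε hε)
      rw [mul_zero, sub_zero, ENNReal.ofReal_mul (Nat.cast_nonneg _), ENNReal.ofReal_natCast] at this
      exact this
    have hmaster := aux_master c hc S hSc w hw U hUc hUd (Ioo 0 ρ) measurableSet_Ioo _ key
    calc μH[2] ((Z' ∩ closedBall 0 ρ) \ Plane3)
        ≤ μH[2] (⋃ j, (({p : E3 | ∃ a b : ℝ, 0 ≤ a ∧ 0 ≤ b ∧ p = a • w j + b • eV} ∩
            closedBall 0 ρ) \ Plane3)) := by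
          refine measure_mono ?_
          rintro x ⟨⟨hx, hxb⟩, hxp⟩
          rw [hZ] at hx
          obtain ⟨j, hj⟩ := mem_iUnion.1 hx
          exact mem_iUnion.2 ⟨j, ⟨hj, hxb⟩, hxp⟩
      _ ≤ ∑ j, μH[2] (({p : E3 | ∃ a b : ℝ, 0 ≤ a ∧ 0 ≤ b ∧ p = a • w j + b • eV} ∩
            closedBall 0 ρ) \ Plane3) := measure_iUnion_fintype_le _ _
      _ ≤ ∑ j : ι, c * ∫⁻ y in Ioo 0 ρ, ENNReal.ofReal (√(ρ ^ 2 - y ^ 2)) :=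
          Finset.sum_le_sum fun j _ => aux_zside c hc (w j) (hw j).1 (hw j).2 ρ hρ
      _ = c * ∫⁻ y in Ioo 0 ρ, (Fintype.card ι : ℝ≥0∞) * ENNReal.ofReal (√(ρ ^ 2 - y ^ 2)) := by
          rw [lintegral_const_mul _ (by fun_prop)]
          simp only [Finset.sum_const, Finset.card_univ, nsmul_eq_mul]
          ring
      _ ≤ _ := hmaster
      _ ≤ _ := by
          refine measure_mono ?_
          rintro x ⟨⟨hxE, hxb⟩, hx2⟩
          refine ⟨⟨hxE, closedBall_subset_ball hρ2 hxb⟩, fun h => ?_⟩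
          have h7 : x 2 = 0 := h
          have h8 : x 2 ∈ Ioo 0 ρ := hx2
          linarith [h8.1]
  set ρ : ℕ → ℝ := fun n => r - r / (n + 3) with hρdef
  have hρmono : Monotone ρ := by
    intro m n hmn
    simp only [hρdef]
    have : (m : ℝ) ≤ n := by exact_mod_cast hmn
    gcongr
  have hρlim : Tendsto ρ atTop (𝓝 r) := by
    have h1 : Tendsto (fun n : ℕ => (n : ℝ) + 3) atTop atTop :=
      tendsto_atTop_add_const_right _ _ tendsto_natCast_atTop_atTop
    have h2 := h1.const_div_atTop r
    simpa using tendsto_const_nhds.sub h2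
  have hsub : ((Z' ∪ Plane3) ∩ ball (0:E3) r) \ Plane3 ⊆ ⋃ n, ((Z' ∩ closedBall 0 (ρ n)) \ Plane3) := by
    rintro x ⟨⟨hx, hxb⟩, hxp⟩
    have hxZ : x ∈ Z' := hx.resolve_right hxp
    rw [mem_ball_zero_iff] at hxb
    obtain ⟨n, hn⟩ := (hρlim.eventually (eventually_gt_nhds hxb)).exists
    exact mem_iUnion.2 ⟨n, ⟨hxZ, by rw [mem_closedBall_zero_iff]; exact hn.le⟩, hxp⟩
  refine (measure_mono hsub).trans ?_
  rw [Monotone.measure_iUnion]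
  · refine iSup_le fun n => main (ρ n) ?_ ?_
    · simp only [hρdef]
      have h3 : (0:ℝ) ≤ n := Nat.cast_nonneg n
      have : r / (n + 3) ≤ r / 3 := by gcongr; linarith
      linarith
    · simp only [hρdef]
      have : 0 < r / ((n:ℝ) + 3) := by positivity
      linarith
  · intro m n hmn
    exact diff_subset_diff_left (inter_subset_inter_right _ (closedBall_subset_closedBall (hρmono hmn)))

theorem aux_Y (w : Fin 3 → E3) (hw : ∀ j, ‖w j‖ = 1 ∧ w j 2 = 0)
    (hww : ∀ j k, j ≠ k → ⟪w j, w k⟫ = -(1/2)) (K : Set E3) (hK : IsCompact K)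
    (hKc : IsPreconnected K) (R : ℝ) (y : ℝ) (hA : ∀ j, R • w j + y • eV ∈ K)
    (ε : ℝ) (hε : 0 < ε) :
    ∃ C : Fin 3 → Set E3, ∃ b : Fin 3 → ℝ, ∑ j, b j = 0 ∧
        (∀ j, IsCompact (C j)) ∧ (∀ j, C j ⊆ K) ∧ (∀ i j, i ≠ j → Disjoint (C i) (C j)) ∧
        ∀ j, Icc (b j + ε) R ⊆ (fun x : E3 => ⟪w j, x⟫) '' C j := by
  obtain ⟨C, b, hb, h1, h2, h3, h4⟩ := aux_tripod K hK hKc (fun j x => ⟪w j, x⟫)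
    (fun j => by fun_prop) (fun j => R • w j + y • eV) hA ε hε
  have hself : ∀ j, ⟪w j, w j⟫ = 1 := fun j => by rw [real_inner_self_eq_norm_sq, (hw j).1]; norm_num
  have hweV : ∀ j, ⟪w j, eV⟫ = 0 := fun j => by
    simp [PiLp.inner_apply, Fin.sum_univ_three, eV_two, eV_zero, eV_one, (hw j).2]
  refine ⟨C, fun j => ⟪w j, b⟫, ?_, h1, h2, h3, fun j => ?_⟩
  · rw [← sum_inner]
    have hz : ∑ j, w j = 0 := by
      rw [← inner_self_eq_zero (𝕜 := ℝ)]
      simp only [Fin.sum_univ_three, inner_add_left, inner_add_right, hself]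
      rw [hww 0 1 (by decide), hww 0 2 (by decide), hww 1 0 (by decide), hww 1 2 (by decide),
        hww 2 0 (by decide), hww 2 1 (by decide)]
      norm_num
    rw [hz, inner_zero_left]
  · have := h4 j
    simp only [inner_add_right, inner_smul_right, hself, hweV, mul_one, mul_zero, add_zero] at this
    exact this

theorem aux_P (u : E3) (hu : ‖u‖ = 1) (hu2 : u 2 = 0) (K : Set E3) (hK : IsCompact K)
    (hKc : IsPreconnected K) (R : ℝ) (hR : 0 < R) (y : ℝ)
    (hA : ∀ j, R • (![u, -u] : Fin 2 → E3) j + y • eV ∈ K)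
    (ε : ℝ) (hε : 0 < ε) :
    ∃ C : Fin 2 → Set E3, ∃ b : Fin 2 → ℝ, ∑ j, b j = 0 ∧
        (∀ j, IsCompact (C j)) ∧ (∀ j, C j ⊆ K) ∧ (∀ i j, i ≠ j → Disjoint (C i) (C j)) ∧
        ∀ j, Icc (b j + ε) R ⊆ (fun x : E3 => ⟪(![u, -u] : Fin 2 → E3) j, x⟫) '' C j := by
  have hself : ⟪u, u⟫ = 1 := by rw [real_inner_self_eq_norm_sq, hu]; norm_num
  have hueV : ⟪u, eV⟫ = 0 := by
    simp [PiLp.inner_apply, Fin.sum_univ_three, eV_two, eV_zero, eV_one, hu2]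
  have h0 := hA 0
  have h1 := hA 1
  simp only [Matrix.cons_val_zero, Matrix.cons_val_one] at h0 h1
  have hiv := hKc.intermediate_value h1 h0 (f := fun x : E3 => ⟪u, x⟫)
    (Continuous.continuousOn (by fun_prop))
  simp only [inner_add_right, inner_smul_right, inner_neg_right, hself, hueV, mul_one, mul_zero,
    add_zero, mul_neg] at hiv
  refine ⟨fun j => K ∩ {x | ε ≤ ⟪(![u, -u] : Fin 2 → E3) j, x⟫}, fun _ => 0, by simp, fun j =>
    hK.inter_right (isClosed_le continuous_const (by fun_prop)), fun j => inter_subset_left, ?_, ?_⟩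
  · have hd : Disjoint (K ∩ {x : E3 | ε ≤ ⟪u, x⟫}) (K ∩ {x : E3 | ε ≤ ⟪-u, x⟫}) := by
      rw [disjoint_left]
      rintro x ⟨_, hx1⟩ ⟨_, hx2⟩
      simp only [mem_ofPred_eq, inner_neg_left] at hx1 hx2
      linarith
    intro i j hij
    fin_cases i <;> fin_cases j
    · exact absurd rfl hij
    · exact hd
    · exact hd.symm
    · exact absurd rfl hij
  · intro j s hs
    rw [zero_add] at hs
    fin_cases j
    · obtain ⟨x, hx, hxs⟩ := hiv (show s ∈ Icc (-R) R from ⟨by linarith [hs.1], hs.2⟩)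
      simp only at hxs
      refine ⟨x, ⟨hx, ?_⟩, ?_⟩
      · simpa [hxs] using hs.1
      · simpa using hxs
    · obtain ⟨x, hx, hxs⟩ := hiv (show -s ∈ Icc (-R) R from ⟨by linarith [hs.2], by linarith [hs.1]⟩)
      simp only at hxs
      refine ⟨x, ⟨hx, ?_⟩, ?_⟩
      · simpa [hxs] using hs.1
      · simp [hxs]

theorem aux_Pcone (v : E3) (hv : ‖v‖ = 1) (hv2 : v 2 = 0) :
    ∃ u : E3, ‖u‖ = 1 ∧ u 2 = 0 ∧ {p : E3 | 0 ≤ p 2 ∧ ⟪v, p⟫ = 0} =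
      ⋃ j : Fin 2, {p : E3 | ∃ a c : ℝ, 0 ≤ a ∧ 0 ≤ c ∧
        p = a • (![u, -u] : Fin 2 → E3) j + c • eV} := by
  have hn : v 0 ^ 2 + v 1 ^ 2 = 1 := by
    have := aux_normsq v
    rw [hv, hv2] at this
    linarith
  refine ⟨!₂[-v 1, v 0, 0], ?_, by simp, ?_⟩
  · have : ‖(!₂[-v 1, v 0, 0] : E3)‖ ^ 2 = 1 := by
      rw [aux_normsq]; simp; linarith
    exact (pow_left_inj₀ (norm_nonneg _) zero_le_one two_ne_zero).1 (by rw [this, one_pow])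
  ext p
  have hin : ⟪v, p⟫ = v 0 * p 0 + v 1 * p 1 := by
    simp [PiLp.inner_apply, Fin.sum_univ_three, hv2, mul_comm]
  simp only [mem_ofPred_eq, mem_iUnion, hin]
  constructor
  · rintro ⟨hp, h0⟩
    have e0 : p 0 = (v 0 * p 1 - v 1 * p 0) * -v 1 := by
      linear_combination (-(p 0)) * hn + v 0 * h0
    have e1 : p 1 = (v 0 * p 1 - v 1 * p 0) * v 0 := by
      linear_combination (-(p 1)) * hn + v 1 * h0
    rcases le_total 0 (v 0 * p 1 - v 1 * p 0) with h | h
    · refine ⟨0, v 0 * p 1 - v 1 * p 0, p 2, h, hp, ?_⟩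
      ext i
      fin_cases i
      · simpa [eV_zero] using e0
      · simpa [eV_one] using e1
      · simp [eV_two]
    · refine ⟨1, -(v 0 * p 1 - v 1 * p 0), p 2, by linarith, hp, ?_⟩
      ext i
      fin_cases i
      · simp [eV_zero]; linarith
      · simp [eV_one]; linarith
      · simp [eV_two]
  · rintro ⟨j, a, c, ha, hc, rfl⟩
    fin_cases j
    · simp [eV_zero, eV_one, eV_two, hc]; ring
    · simp [eV_zero, eV_one, eV_two, hc]; ring

/-- let π(x) = x₃, Z = Z' ∪ L₁ with Z' of type ℙ₊ or 𝕐₊, and let E ⊆ Ω be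
closed with L₁ ⊆ E, coinciding with Z outside B(0, r/2), such that for a.e. y ∈ (0,r) the
slice E ∩ π⁻¹(y) is a connected closed set coinciding with Z ∩ π⁻¹(y) outside B(0,1).
Then H²(E ∩ B(0,r) \ L₁) ≥ H²(Z ∩ B(0,r) \ L₁). -/
theorem stmt18 (Z' E : Set E3) (hZ' : ConeTypeP Z' ∨ ConeTypeY Z')
    (r : ℝ) (hr : 0 < r)
    (hEcl : IsClosed E) (hEΩ : E ⊆ Omega3) (hL : Plane3 ⊆ E)
    (hout : ∀ x : E3, x ∉ ball (0:E3) (r/2) → (x ∈ E ↔ x ∈ Z' ∪ Plane3))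
    (hslice : ∀ᵐ y ∂(volume.restrict (Set.Ioo (0:ℝ) r)),
      IsConnected {x : E3 | x ∈ E ∧ x 2 = y} ∧
      IsClosed {x : E3 | x ∈ E ∧ x 2 = y} ∧
      ∀ x : E3, x ∉ ball (0:E3) 1 →
        ((x ∈ E ∧ x 2 = y) ↔ (x ∈ Z' ∪ Plane3 ∧ x 2 = y))) :
    μH[2] (((Z' ∪ Plane3) ∩ ball (0:E3) r) \ Plane3) ≤
      μH[2] ((E ∩ ball (0:E3) r) \ Plane3) := by
  have hsl : ∀ᵐ y ∂(volume.restrict (Set.Ioo (0:ℝ) r)),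
      IsConnected {x : E3 | x ∈ E ∧ x 2 = y} := hslice.mono fun y hy => hy.1
  rcases hZ' with ⟨v, hv, hv2, hZ⟩ | ⟨w, hw, hww, hZ⟩
  · obtain ⟨u, hu, hu2, hcone⟩ := aux_Pcone v hv hv2
    refine aux_star (![u, -u] : Fin 2 → E3) ?_ ?_ Z' E (hZ.trans hcone) r hr hEcl hout hsl
    · intro j
      fin_cases j
      · exact ⟨hu, hu2⟩
      · exact ⟨by simpa using hu, by simpa using hu2⟩
    · intro K hK hKc R hR y hA ε hε
      exact aux_P u hu hu2 K hK hKc R hR y hA ε hε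
  · refine aux_star w hw ?_ Z' E hZ r hr hEcl hout hsl
    intro K hK hKc R hR y hA ε hε
    exact aux_Y w hw hww K hK hKc R y hA ε hε

end
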